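/- The map ι₃(u,v) = ( vb(v+u+1)(u+v)/D, au(u+v)/D ) with D = buv + bv² + au + bv preserves the invariant F/G with F(u,v) = v²(1+u+v) + au(u/b + uv + v²) and G(u,v) = uv: F(ι₃(u,v))·G(u,v) = F(u,v)·G(ι₃(u,v)) wherever all quantities are defined. -/

import Mathlib

noncomputable def Fcub {K : Type*} [Field K] (a b u v : K) : K :=
  v^2 * (1 + u + v) + a*u*(u/b + u*v + v^2)

def Gcub {K : Type*} [Field K] (u v : K) : K := u * v

def Dden {K : Type*} [Field K] (a b u v : K) : K := b*u*v + b*v^2 + a*u + b*v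

noncomputable def iota3 {K : Type*} [Field K] (a b : K) (p : K × K) : K × K :=
  (b * p.2 * (p.1 + p.2 + 1) * (p.1 + p.2) / Dden a b p.1 p.2,
   a * p.1 * (p.1 + p.2) / Dden a b p.1 p.2)

/-- ι₃ preserves the invariant F/G. -/
theorem iota3_preserves_invariant {K : Type*} [Field K] (a b u v : K)
    (ha : a ≠ 0) (hb : b ≠ 0) (hD : Dden a b u v ≠ 0) (hG : u * v ≠ 0) :
    Fcub a b (iota3 a b (u, v)).1 (iota3 a b (u, v)).2 * Gcub u v =
      Fcub a b u v * Gcub (iota3 a b (u, v)).1 (iota3 a b (u, v)).2 := by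
  simp only [Fcub, Gcub, iota3]
  generalize hd : Dden a b u v = d at hD ⊢
  field_simp
  rw [← hd, Dden]
  ring
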